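/- Let (M, I(M)) be a pi-space and let X ⊆ M be a finitely closed subset of positive rank. Then the collection of flats of finite positive rank contained in X is nonempty and directed: for any two flats F, G of finite positive rank contained in X, their join F ∨ G is again a flat of finite positive rank contained in X. -/

import Mathlib

open Set

/-- A pre-independence space (pi-space): a non-empty ground set `M` together with a
non-empty collection `Ind` of subsets of `M` (the independent sets) that is closed
under taking subsets (I1) and satisfies the finite exchange property (I2). -/
structure PiSpace (α : Type*) where
  M : Set α
  Ind : Set (Set α)
  M_nonempty : M.Nonempty
  Ind_nonempty : Ind.Nonempty
  ind_subset_M : ∀ σ ∈ Ind, σ ⊆ M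
  downward_closed : ∀ σ ∈ Ind, ∀ τ ⊆ σ, τ ∈ Ind
  exchange : ∀ σ ∈ Ind, ∀ τ ∈ Ind, σ.Finite → τ.Finite → τ.ncard < σ.ncard →
    ∃ x ∈ σ \ τ, insert x τ ∈ Ind

namespace PiSpace

variable {α : Type*}

/-- Condition (FC): a pi-space is a finitary matroid if every set all of whose finite
subsets are independent is itself independent. -/
def Finitary (P : PiSpace α) : Prop :=
  ∀ σ ⊆ P.M, (∀ τ ⊆ σ, τ.Finite → τ ∈ P.Ind) → σ ∈ P.Ind

/-- The set of finite independent sets `I(M)_fin`. -/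
def IndFin (P : PiSpace α) : Set (Set α) := {σ ∈ P.Ind | σ.Finite}

/-- The family `I(M)_W` of sets all of whose finite subsets are independent. -/
def IndW (P : PiSpace α) : Set (Set α) :=
  {σ | σ ⊆ P.M ∧ ∀ τ ⊆ σ, τ.Finite → τ ∈ P.Ind}

/-- The independent sets contained in `N`, i.e. `I(M,N)`. -/
def restrictInd (P : PiSpace α) (N : Set α) : Set (Set α) := {σ ∈ P.Ind | σ ⊆ N}

/-- `I(M.X)`: independent sets of the contraction of `M` by `M \ X`. -/
def contractInd (P : PiSpace α) (X : Set α) : Set (Set α) :=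
  {σ ∈ P.restrictInd X | ∃ τ ∈ P.restrictInd (P.M \ X),
    (∀ ρ ∈ P.restrictInd (P.M \ X), τ ⊆ ρ → ρ = τ) ∧ σ ∪ τ ∈ P.Ind}

/-- The rank of a subset `X`: the supremum of the cardinalities (in `ℕ∞`) of the
independent sets contained in `X`. -/
noncomputable def rk (P : PiSpace α) (X : Set α) : ℕ∞ :=
  ⨆ σ ∈ {σ : Set α | σ ∈ P.Ind ∧ σ ⊆ X}, σ.encard

/-- A flat of a pi-space. -/
def IsFlat (P : PiSpace α) (F : Set α) : Prop :=
  F ⊆ P.M ∧ ∀ x ∈ P.M \ F, ∀ σ ∈ P.Ind, σ ⊆ F → insert x σ ∈ P.Ind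

/-- The set of loops `0_{I(M)}`. -/
def loops (P : PiSpace α) : Set α := {x ∈ P.M | {x} ∉ P.Ind}

/-- A dependent subset of `M`. -/
def Dep (P : PiSpace α) (X : Set α) : Prop := X ⊆ P.M ∧ X ∉ P.Ind

/-- A circuit: a minimal dependent set. -/
def IsCircuit (P : PiSpace α) (C : Set α) : Prop :=
  P.Dep C ∧ ∀ C' ⊂ C, C' ∈ P.Ind

/-- The closure of a subset `X`. -/
def cl (P : PiSpace α) (X : Set α) : Set α :=
  X ∪ {x ∈ P.M | ∃ C, P.IsCircuit C ∧ x ∈ C ∧ C ⊆ X ∪ {x}}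

/-- The join of two flats: the intersection of all flats containing both. -/
def flatJoin (P : PiSpace α) (F G : Set α) : Set α :=
  ⋂₀ {H | P.IsFlat H ∧ F ⊆ H ∧ G ⊆ H}

/-- `Φ(σ)`: the intersection of all flats containing `σ`. -/
def Phi (P : PiSpace α) (σ : Set α) : Set α := ⋂₀ {F | P.IsFlat F ∧ σ ⊆ F}

/-- A finitely closed set: it contains the closure of each of its finite
independent subsets. -/
def FinitelyClosed (P : PiSpace α) (X : Set α) : Prop :=
  ∀ σ ∈ P.Ind, σ ⊆ X → σ.Finite → P.cl σ ⊆ X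

/-- An atom of the poset of flats: a flat strictly containing the loops and
minimal with this property. -/
def IsFlatAtom (P : PiSpace α) (A : Set α) : Prop :=
  P.IsFlat A ∧ P.loops ⊂ A ∧ ∀ F, P.IsFlat F → P.loops ⊂ F → F ⊆ A → F = A

end PiSpace

/-- Flats of an arbitrary pair (ground set, family of independent sets). -/
def IsFlatIn {α : Type*} (Mset : Set α) (Ind : Set (Set α)) (F : Set α) : Prop :=
  F ⊆ Mset ∧ ∀ x ∈ Mset \ F, ∀ σ ∈ Ind, σ ⊆ F → insert x σ ∈ Ind

/-- The rank of `X` with respect to a family `Ind` of independent sets. -/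
noncomputable def rkIn {α : Type*} (Ind : Set (Set α)) (X : Set α) : ℕ∞ :=
  ⨆ σ ∈ {σ : Set α | σ ∈ Ind ∧ σ ⊆ X}, σ.encard

namespace PiSpace

variable {α : Type*} {P : PiSpace α}

theorem encard_le_rk {σ X : Set α} (hσ : σ ∈ P.Ind) (hσX : σ ⊆ X) : σ.encard ≤ P.rk X :=
  le_iSup₂_of_le (f := fun (σ : Set α) (_ : σ ∈ {σ : Set α | σ ∈ P.Ind ∧ σ ⊆ X}) => σ.encard)
    σ ⟨hσ, hσX⟩ le_rfl

theorem rk_le {X : Set α} {n : ℕ∞} (h : ∀ σ ∈ P.Ind, σ ⊆ X → σ.encard ≤ n) : P.rk X ≤ n :=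
  iSup₂_le fun σ hσ => h σ hσ.1 hσ.2

theorem rk_mono {X Y : Set α} (h : X ⊆ Y) : P.rk X ≤ P.rk Y :=
  rk_le fun _ hσ hσX => encard_le_rk hσ (hσX.trans h)

theorem rk_union_le (X Y : Set α) : P.rk (X ∪ Y) ≤ P.rk X + P.rk Y :=
  rk_le fun σ hσ hσXY => calc
    σ.encard = (σ ∩ X ∪ σ ∩ Y).encard := by
      rw [← inter_union_distrib_left, inter_eq_left.2 hσXY]
    _ ≤ (σ ∩ X).encard + (σ ∩ Y).encard := encard_union_le _ _
    _ ≤ P.rk X + P.rk Y := add_le_add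
      (encard_le_rk (P.downward_closed σ hσ _ inter_subset_left) inter_subset_right)
      (encard_le_rk (P.downward_closed σ hσ _ inter_subset_left) inter_subset_right)

theorem empty_mem_Ind : ∅ ∈ P.Ind :=
  let ⟨σ, hσ⟩ := P.Ind_nonempty
  P.downward_closed σ hσ _ (empty_subset σ)

theorem exists_ind_superset_ncard_eq {σ τ : Set α} (hσ : σ ∈ P.Ind) (hσf : σ.Finite)
    (hτ : τ ∈ P.Ind) (hτf : τ.Finite) (hle : τ.ncard ≤ σ.ncard) :
    ∃ ρ ∈ P.Ind, τ ⊆ ρ ∧ ρ ⊆ τ ∪ σ ∧ ρ.ncard = σ.ncard := by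
  induction hk : σ.ncard - τ.ncard generalizing τ with
  | zero => exact ⟨τ, hτ, Subset.rfl, subset_union_left, by omega⟩
  | succ k ih =>
    obtain ⟨x, ⟨hxσ, hxτ⟩, hx⟩ := P.exchange σ hσ τ hτ hσf hτf (by omega)
    have hcard := ncard_insert_of_notMem hxτ hτf
    obtain ⟨ρ, hρ, hτρ, hρσ, hρc⟩ := ih hx (hτf.insert x) (by omega) (by omega)
    refine ⟨ρ, hρ, (subset_insert x τ).trans hτρ, hρσ.trans ?_, hρc⟩
    exact union_subset (insert_subset (Or.inr hxσ) subset_union_left) subset_union_right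

theorem cl_subset_M {σ : Set α} (hσ : σ ⊆ P.M) : P.cl σ ⊆ P.M :=
  union_subset hσ fun _ hx => hx.1

theorem mem_cl_of_insert_notMem_Ind {σ : Set α} (hσ : σ ∈ P.Ind) (hσf : σ.Finite) {x : α}
    (hx : x ∈ P.M) (hdep : insert x σ ∉ P.Ind) : x ∈ P.cl σ := by
  have hfin : {C | C ⊆ insert x σ ∧ C ∉ P.Ind}.Finite :=
    (hσf.insert x).finite_subsets.subset fun _ hC => hC.1
  obtain ⟨C, -, hC⟩ := hfin.exists_le_minimal (a := insert x σ) ⟨Subset.rfl, hdep⟩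
  refine Or.inr ⟨hx, C, ⟨⟨hC.prop.1.trans (insert_subset hx (P.ind_subset_M σ hσ)), hC.prop.2⟩,
    fun D hDC => ?_⟩, ?_, hC.prop.1.trans (by simp)⟩
  · by_contra hD
    exact hDC.2 (hC.2 ⟨hDC.1.trans hC.prop.1, hD⟩ hDC.1)
  · by_contra hxC
    exact hC.prop.2 (P.downward_closed σ hσ C ((subset_insert_iff_of_notMem hxC).1 hC.prop.1))

theorem insert_notMem_Ind_of_mem_cl {σ : Set α} {x : α} (hx : x ∈ P.cl σ) (hxσ : x ∉ σ) :
    insert x σ ∉ P.Ind := by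
  obtain hx | ⟨-, C, hC, -, hCσ⟩ := hx
  · exact absurd hx hxσ
  · exact fun h => hC.1.2 (P.downward_closed _ h C (hCσ.trans (by simp)))

theorem encard_le_of_subset_cl {σ τ : Set α} (hσ : σ ∈ P.Ind) (hσf : σ.Finite)
    (hτ : τ ∈ P.Ind) (hτσ : τ ⊆ P.cl σ) : τ.encard ≤ σ.encard := by
  by_contra! hlt
  obtain ⟨υ, hυτ, hυ⟩ := exists_subset_encard_eq (Order.add_one_le_of_lt hlt)
  rw [← hσf.cast_ncard_eq] at hυ
  have hυf : υ.Finite := finite_of_encard_eq_coe (k := σ.ncard + 1) (by simpa using hυ)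
  have hcard : υ.ncard = σ.ncard + 1 := by
    rw [← hυf.cast_ncard_eq] at hυ
    exact_mod_cast hυ
  obtain ⟨x, ⟨hxυ, hxσ⟩, hx⟩ :=
    P.exchange υ (P.downward_closed τ hτ υ hυτ) σ hσ hυf hσf (by omega)
  exact insert_notMem_Ind_of_mem_cl (hτσ (hυτ hxυ)) hxσ hx

theorem rk_cl_le {σ : Set α} (hσ : σ ∈ P.Ind) (hσf : σ.Finite) : P.rk (P.cl σ) ≤ σ.encard :=
  rk_le fun _ hτ hτσ => encard_le_of_subset_cl hσ hσf hτ hτσ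

theorem rk_cl_lt_top {σ : Set α} (hσ : σ ∈ P.Ind) (hσf : σ.Finite) : P.rk (P.cl σ) < ⊤ :=
  (rk_cl_le hσ hσf).trans_lt hσf.encard_lt_top

theorem isFlat_cl {σ : Set α} (hσ : σ ∈ P.Ind) (hσf : σ.Finite) : P.IsFlat (P.cl σ) := by
  refine ⟨cl_subset_M (P.ind_subset_M σ hσ), fun x ⟨hxM, hxσ⟩ τ hτ hτσ => ?_⟩
  have hx : insert x σ ∈ P.Ind := by
    by_contra h
    exact hxσ (mem_cl_of_insert_notMem_Ind hσ hσf hxM h)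
  have hcard := ncard_insert_of_notMem (fun h => hxσ (Or.inl h)) hσf
  have hle := encard_le_of_subset_cl hσ hσf hτ hτσ
  have hτf : τ.Finite := finite_of_encard_le_coe (k := σ.ncard) (by rwa [hσf.cast_ncard_eq])
  rw [← hτf.cast_ncard_eq, ← hσf.cast_ncard_eq, Nat.cast_le] at hle
  obtain ⟨ρ, hρ, hτρ, hρσ, hρc⟩ :=
    exists_ind_superset_ncard_eq hx (hσf.insert x) hτ hτf (by omega)
  refine P.downward_closed ρ hρ _ (insert_subset ?_ hτρ)
  by_contra hxρ
  have hρcl : ρ ⊆ P.cl σ := fun y hy => by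
    obtain h | rfl | h := hρσ hy
    · exact hτσ h
    · exact absurd hy hxρ
    · exact Or.inl h
  have h := encard_le_of_subset_cl hσ hσf hρ hρcl
  have hρf : ρ.Finite := (hτf.union (hσf.insert x)).subset hρσ
  rw [← hρf.cast_ncard_eq, ← hσf.cast_ncard_eq, Nat.cast_le] at h
  omega

theorem exists_finite_ind_subset_cl {Y : Set α} (hY : Y ⊆ P.M) (hrk : P.rk Y < ⊤) :
    ∃ σ ∈ P.Ind, σ.Finite ∧ σ ⊆ Y ∧ Y ⊆ P.cl σ := by
  obtain ⟨n, hn⟩ := ENat.ne_top_iff_exists.1 hrk.ne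
  have hfin : ∀ σ ∈ P.Ind, σ ⊆ Y → σ.Finite ∧ σ.ncard ≤ n := fun σ hσ hσY => by
    have h := encard_le_rk hσ hσY
    rw [← hn] at h
    have hσf := finite_of_encard_le_coe h
    rw [← hσf.cast_ncard_eq, Nat.cast_le] at h
    exact ⟨hσf, h⟩
  have hbdd : (ncard '' {σ | σ ∈ P.Ind ∧ σ ⊆ Y}).Finite :=
    (finite_Iic n).subset (image_subset_iff.2 fun σ hσ => (hfin σ hσ.1 hσ.2).2)
  obtain ⟨σ, ⟨hσ, hσY⟩, hmax⟩ :=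
    Finite.exists_maximalFor' ncard {σ | σ ∈ P.Ind ∧ σ ⊆ Y} hbdd
      ⟨∅, empty_mem_Ind, empty_subset Y⟩
  have hσf := (hfin σ hσ hσY).1
  refine ⟨σ, hσ, hσf, hσY, fun x hx => ?_⟩
  by_contra hxσ
  have hins : insert x σ ∈ P.Ind := by
    by_contra h
    exact hxσ (mem_cl_of_insert_notMem_Ind hσ hσf (hY hx) h)
  have hcard := ncard_insert_of_notMem (fun h => hxσ (Or.inl h)) hσf
  have hle := hmax ⟨hins, insert_subset hx hσY⟩ (by omega)
  omega

theorem isFlat_ground (P : PiSpace α) : P.IsFlat P.M :=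
  ⟨Subset.rfl, fun _ hx => absurd hx.1 hx.2⟩

theorem isFlat_flatJoin {F G : Set α} (hF : P.IsFlat F) (hG : P.IsFlat G) :
    P.IsFlat (P.flatJoin F G) := by
  refine ⟨sInter_subset_of_mem ⟨P.isFlat_ground, hF.1, hG.1⟩, fun x ⟨hxM, hx⟩ σ hσ hσJ => ?_⟩
  simp only [flatJoin, mem_sInter, not_forall] at hx
  obtain ⟨H, hH, hxH⟩ := hx
  exact hH.1.2 x ⟨hxM, hxH⟩ σ hσ (hσJ.trans (sInter_subset_of_mem hH))

theorem subset_flatJoin_left (F G : Set α) : F ⊆ P.flatJoin F G :=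
  subset_sInter fun _ hH => hH.2.1

end PiSpace

/-- If `X ⊆ M` is finitely closed of positive rank, then the
collection of flats of finite positive rank contained in `X` is nonempty and
directed: the join of two such flats is again such a flat. -/
theorem finite_rank_flats_in_finitely_closed_directed {α : Type*} (P : PiSpace α)
    (X : Set α) (hX : X ⊆ P.M) (hfc : P.FinitelyClosed X) (hpos : 0 < P.rk X) :
    {F | P.IsFlat F ∧ F ⊆ X ∧ 0 < P.rk F ∧ P.rk F < ⊤}.Nonempty ∧
    (∀ F G, P.IsFlat F → F ⊆ X → 0 < P.rk F → P.rk F < ⊤ →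
      P.IsFlat G → G ⊆ X → 0 < P.rk G → P.rk G < ⊤ →
      P.IsFlat (P.flatJoin F G) ∧ P.flatJoin F G ⊆ X ∧
        0 < P.rk (P.flatJoin F G) ∧ P.rk (P.flatJoin F G) < ⊤) := by
  refine ⟨?_, fun F G hF hFX hF0 hFt hG hGX _ hGt => ?_⟩
  · obtain ⟨σ, hσ, hσX, hne⟩ : ∃ σ ∈ P.Ind, σ ⊆ X ∧ σ.Nonempty := by
      by_contra! h
      refine hpos.not_ge (PiSpace.rk_le fun σ hσ hσX => ?_)
      simp [h σ hσ hσX]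
    obtain ⟨x, hx⟩ := hne
    have hxI : {x} ∈ P.Ind := P.downward_closed σ hσ _ (singleton_subset_iff.2 hx)
    refine ⟨P.cl {x}, PiSpace.isFlat_cl hxI (finite_singleton x),
      hfc _ hxI (singleton_subset_iff.2 (hσX hx)) (finite_singleton x), ?_,
      PiSpace.rk_cl_lt_top hxI (finite_singleton x)⟩
    exact lt_of_lt_of_le (by simp) (PiSpace.encard_le_rk hxI subset_union_left)
  · obtain ⟨σ, hσ, hσf, hσY, hcl⟩ := PiSpace.exists_finite_ind_subset_cl
      (union_subset hF.1 hG.1)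
      ((PiSpace.rk_union_le (P := P) F G).trans_lt (WithTop.add_lt_top.2 ⟨hFt, hGt⟩))
    have hJ : P.flatJoin F G ⊆ P.cl σ := sInter_subset_of_mem
      ⟨PiSpace.isFlat_cl hσ hσf, subset_union_left.trans hcl, subset_union_right.trans hcl⟩
    exact ⟨PiSpace.isFlat_flatJoin hF hG,
      hJ.trans (hfc σ hσ (hσY.trans (union_subset hFX hGX)) hσf),
      hF0.trans_le (PiSpace.rk_mono (PiSpace.subset_flatJoin_left F G)),
      (PiSpace.rk_mono hJ).trans_lt (PiSpace.rk_cl_lt_top hσ hσf)⟩
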